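/- arXiv:2309.13482 — 6 statements merged into one kernel-verified Lean document; each statement's English description precedes it below -/
import Mathlib

section
/- Assume α(x) = ⟨exp(Ax) + Ax, 1_n⟩ ≠ 0. For each i ∈ [d], the partial derivative of f(x) = α(x)^{-1}(exp(Ax) + Ax) with respect to x_i satisfies ∂f(x)/∂x_i = α(x)^{-1} (I_n − f(x)·1_n^⊤) · v_i(x), where v_i(x) = (exp(Ax) + 1_n) ∘ A_{*,i}. -/
open Matrix

/-- Euclidean (ℓ₂) norm of a vector in ℝ^m. -/
noncomputable def vecNorm2 {m : ℕ} (v : Fin m → ℝ) : ℝ := Real.sqrt (∑ i, (v i) ^ 2)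

/-- ℓ₁ norm of a vector in ℝ^m. -/
noncomputable def vecNorm1 {m : ℕ} (v : Fin m → ℝ) : ℝ := ∑ i, |v i|

/-- Spectral norm of a matrix: operator norm of the induced map between Euclidean spaces. -/
noncomputable def specNorm {m k : ℕ} (A : Matrix (Fin m) (Fin k) ℝ) : ℝ :=
  ‖(Matrix.toEuclideanLin A).toContinuousLinearMap‖

/-- Loewner order: `U ⪯ V` iff `vᵀ U v ≤ vᵀ V v` for all vectors `v`. -/
def loewnerLE {m : ℕ} (U V : Matrix (Fin m) (Fin m) ℝ) : Prop :=
  ∀ v : Fin m → ℝ, v ⬝ᵥ (U *ᵥ v) ≤ v ⬝ᵥ (V *ᵥ v)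

variable {n d : ℕ}

/-- `exp(Ax)`, the entrywise exponential of `A x`. -/
noncomputable def expv (A : Matrix (Fin n) (Fin d) ℝ) (x : Fin d → ℝ) : Fin n → ℝ :=
  fun j => Real.exp (A.mulVec x j)

/-- `u(x) = exp(Ax) + Ax`. -/
noncomputable def uf (A : Matrix (Fin n) (Fin d) ℝ) (x : Fin d → ℝ) : Fin n → ℝ :=
  fun j => expv A x j + A.mulVec x j

/-- `α(x) = ⟨u(x), 1_n⟩`. -/
noncomputable def alphaf (A : Matrix (Fin n) (Fin d) ℝ) (x : Fin d → ℝ) : ℝ :=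
  ∑ j, uf A x j

/-- `f(x) = α(x)⁻¹ u(x)`. -/
noncomputable def ff (A : Matrix (Fin n) (Fin d) ℝ) (x : Fin d → ℝ) : Fin n → ℝ :=
  (alphaf A x)⁻¹ • uf A x

/-- `v_i(x) = (exp(Ax) + 1_n) ∘ A_{*,i}`. -/
noncomputable def vf (A : Matrix (Fin n) (Fin d) ℝ) (i : Fin d) (x : Fin d → ℝ) : Fin n → ℝ :=
  fun j => (expv A x j + 1) * A j i

/-- `c(x) = f(x) - b`. -/
noncomputable def cf (A : Matrix (Fin n) (Fin d) ℝ) (b : Fin n → ℝ) (x : Fin d → ℝ) : Fin n → ℝ :=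
  fun j => ff A x j - b j

/-- `L(x) = 0.5 ‖c(x)‖₂²`. -/
noncomputable def Lf (A : Matrix (Fin n) (Fin d) ℝ) (b : Fin n → ℝ) (x : Fin d → ℝ) : ℝ :=
  0.5 * ∑ j, (cf A b x j) ^ 2

/-- `z(x) = exp(Ax) + 1_n`. -/
noncomputable def zf (A : Matrix (Fin n) (Fin d) ℝ) (x : Fin d → ℝ) : Fin n → ℝ :=
  fun j => expv A x j + 1

/-- `K(x) = I_n - f(x) · 1_nᵀ`. -/
noncomputable def Kf (A : Matrix (Fin n) (Fin d) ℝ) (x : Fin d → ℝ) : Matrix (Fin n) (Fin n) ℝ :=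
  1 - vecMulVec (ff A x) (fun _ => 1)

/-- `c̃(x) = K(x)ᵀ c(x)`. -/
noncomputable def ctf (A : Matrix (Fin n) (Fin d) ℝ) (b : Fin n → ℝ) (x : Fin d → ℝ) : Fin n → ℝ :=
  (Kf A x)ᵀ *ᵥ cf A b x

/-- `B_mat(x) = α(x)⁻² diag(z(x)) K(x)ᵀ K(x) diag(z(x))`. -/
noncomputable def Bmat (A : Matrix (Fin n) (Fin d) ℝ) (x : Fin d → ℝ) : Matrix (Fin n) (Fin n) ℝ :=
  ((alphaf A x) ^ 2)⁻¹ • (diagonal (zf A x) * (Kf A x)ᵀ * Kf A x * diagonal (zf A x))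

/-- `B_rank(x) = α(x)⁻² (z(x) c̃(x)ᵀ diag(z(x)) + diag(z(x)) c̃(x) z(x)ᵀ)`. -/
noncomputable def Brank (A : Matrix (Fin n) (Fin d) ℝ) (b : Fin n → ℝ) (x : Fin d → ℝ) :
    Matrix (Fin n) (Fin n) ℝ :=
  ((alphaf A x) ^ 2)⁻¹ •
    (vecMulVec (zf A x) (ctf A b x) * diagonal (zf A x)
      + diagonal (zf A x) * vecMulVec (ctf A b x) (zf A x))

/-- `B_diag(x) = α(x)⁻¹ diag(c̃(x) ∘ exp(Ax))`. -/
noncomputable def Bdiag (A : Matrix (Fin n) (Fin d) ℝ) (b : Fin n → ℝ) (x : Fin d → ℝ) :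
    Matrix (Fin n) (Fin n) ℝ :=
  (alphaf A x)⁻¹ • diagonal (fun j => ctf A b x j * expv A x j)

/-- `B(x) = B_mat(x) - B_rank(x) + B_diag(x)`. -/
noncomputable def Bf (A : Matrix (Fin n) (Fin d) ℝ) (b : Fin n → ℝ) (x : Fin d → ℝ) :
    Matrix (Fin n) (Fin n) ℝ :=
  Bmat A x - Brank A b x + Bdiag A b x

/-- Hessian matrix of the loss `L`, with `H(x)_{ij} = ∂²L/∂x_i∂x_j`. -/
noncomputable def Hf (A : Matrix (Fin n) (Fin d) ℝ) (b : Fin n → ℝ) (x : Fin d → ℝ) :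
    Matrix (Fin d) (Fin d) ℝ :=
  Matrix.of fun i j =>
    fderiv ℝ (fun y => fderiv ℝ (Lf A b) y (Pi.single j 1)) x (Pi.single i 1)

/-- Total derivative of one coordinate of `u`. -/
theorem uf_hasFDerivAt_aux (n d : ℕ) (A : Matrix (Fin n) (Fin d) ℝ) (x : Fin d → ℝ) (j : Fin n) :
    HasFDerivAt (fun y => uf A y j)
      ((Real.exp (A.mulVec x j) + 1) •
        ((ContinuousLinearMap.proj j).comp (LinearMap.toContinuousLinearMap A.mulVecLin) :
          (Fin d → ℝ) →L[ℝ] ℝ)) x := by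
  have hl : HasFDerivAt (fun y : Fin d → ℝ => A.mulVec y j)
      ((ContinuousLinearMap.proj j).comp (LinearMap.toContinuousLinearMap A.mulVecLin) :
          (Fin d → ℝ) →L[ℝ] ℝ) x :=
    ((ContinuousLinearMap.proj j).comp (LinearMap.toContinuousLinearMap A.mulVecLin) :
          (Fin d → ℝ) →L[ℝ] ℝ).hasFDerivAt
  have h := hl.exp.add hl
  rw [add_smul, one_smul]
  exact h

/-- if α(x) ≠ 0, then ∂f/∂x_i = α(x)⁻¹ (I_n − f(x)·1_nᵀ) v_i(x). -/
theorem stmt2 (n d : ℕ) (A : Matrix (Fin n) (Fin d) ℝ) (x : Fin d → ℝ)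
    (hα : alphaf A x ≠ 0) (i : Fin d) :
    fderiv ℝ (ff A) x (Pi.single i 1)
      = (alphaf A x)⁻¹ • ((1 - vecMulVec (ff A x) (fun _ => 1)) *ᵥ vf A i x) := by
  have hu := uf_hasFDerivAt_aux n d A x
  have ha : HasFDerivAt (alphaf A) _ x := HasFDerivAt.fun_sum (u := Finset.univ) fun j _ => hu j
  have hf : HasFDerivAt (ff A) _ x := hasFDerivAt_pi.2 fun j =>
    ((hasFDerivAt_inv hα).comp x ha).mul (hu j)
  rw [hf.fderiv]
  ext j
  have hs : (fun _ => 1 : Fin n → ℝ) ⬝ᵥ vf A i x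
      = ∑ k, (Real.exp (A.mulVec x k) + 1) * A k i := by
    simp [dotProduct, vf, expv]
  rw [Matrix.sub_mulVec, Matrix.one_mulVec, Matrix.vecMulVec_mulVec, hs]
  simp [ff, vf, expv]
  simp only [← mul_assoc, ← Finset.sum_mul]
  field_simp
  ring
end

section
/- Assume α(x) = ⟨exp(Ax) + Ax, 1_n⟩ ≠ 0. For each i ∈ [d], the partial derivative of the loss L(x) = 0.5‖f(x) − b‖_2² with respect to x_i satisfies ∂L(x)/∂x_i = α(x)^{-1} · c(x)^⊤ · (I_n − f(x)·1_n^⊤) · v_i(x), where c(x) = f(x) − b and v_i(x) = (exp(Ax) + 1_n) ∘ A_{*,i}. -/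
open Matrix

variable {n d : ℕ}

/-- if α(x) ≠ 0, then ∂L/∂x_i = α(x)⁻¹ c(x)ᵀ (I_n − f(x)·1_nᵀ) v_i(x). -/
theorem stmt3 (n d : ℕ) (A : Matrix (Fin n) (Fin d) ℝ) (b : Fin n → ℝ) (x : Fin d → ℝ)
    (hα : alphaf A x ≠ 0) (i : Fin d) :
    fderiv ℝ (Lf A b) x (Pi.single i 1)
      = (alphaf A x)⁻¹ *
          (cf A b x ⬝ᵥ ((1 - vecMulVec (ff A x) (fun _ => 1)) *ᵥ vf A i x)) := by
  have hl : ∀ j, ∃ l : (Fin d → ℝ) →L[ℝ] ℝ, (∀ y, l y = A.mulVec y j) := fun j =>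
    ⟨LinearMap.toContinuousLinearMap ((LinearMap.proj j).comp A.mulVecLin), fun y => by simp⟩
  choose l hl using hl
  have hl1 : ∀ j, l j (Pi.single i 1) = A j i := fun j => by simp [hl]
  have hm : ∀ j, HasFDerivAt (fun y => A.mulVec y j) (l j) x := fun j => by
    have := (l j).hasFDerivAt (x := x)
    exact this.congr_of_eventuallyEq (Filter.Eventually.of_forall fun y => (hl j y).symm)
  have hu : ∀ j, HasFDerivAt (fun y => uf A y j) (expv A x j • l j + l j) x := fun j =>
    (hm j).exp.add (hm j)
  have ha : HasFDerivAt (fun y => alphaf A y) (∑ j, (expv A x j • l j + l j)) x :=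
    HasFDerivAt.fun_sum fun j _ => hu j
  have hai := (hasDerivAt_inv hα).comp_hasFDerivAt x ha
  have hc := fun j => ((hai.mul (hu j)).sub_const (b j)).pow 2
  have hL := (HasFDerivAt.fun_sum fun j (_ : j ∈ Finset.univ) => hc j).const_mul (0.5 : ℝ)
  have hL' : HasFDerivAt (Lf A b) _ x := hL
  rw [hL'.fderiv]
  have hs : (∑ j, (expv A x j • l j + l j)) (Pi.single i 1) = ∑ j, vf A i x j := by
    simp [hl1, vf, add_mul]
  have hmv : ∀ j, ((1 - vecMulVec (ff A x) (fun _ => 1)) *ᵥ vf A i x) j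
      = vf A i x j - ff A x j * ∑ k, vf A i x k := fun j => by
    rw [Matrix.sub_mulVec, Matrix.one_mulVec]
    simp [Matrix.mulVec, dotProduct, vecMulVec_apply, Finset.mul_sum]
  have hu1 : ∀ j, (expv A x j • l j + l j) (Pi.single i 1) = vf A i x j := fun j => by
    simp [hl1, vf, add_mul]
  generalize (∑ j, (expv A x j • l j + l j)) = D at *
  generalize hE : (fun j => (expv A x j • l j + l j)) = E at *
  have hE' : ∀ j, (expv A x j • l j + l j) = E j := fun j => by rw [← hE]
  simp only [hE'] at *
  simp only [dotProduct, hmv, _root_.smul_apply, _root_.sum_apply,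
    _root_.add_apply, smul_eq_mul, hs, hu1]
  generalize (∑ k, vf A i x k) = S at *
  rw [Finset.mul_sum, Finset.mul_sum]
  refine Finset.sum_congr rfl fun j _ => ?_
  simp only [cf, ff, Pi.smul_apply, smul_eq_mul, Function.comp, Pi.mul_apply]
  simp
  field_simp
  ring
end

section
/- Assume α(x) = ⟨exp(Ax) + Ax, 1_n⟩ ≠ 0. For all i, j ∈ [d], the second partial derivative of the loss L(x) = 0.5‖f(x) − b‖_2² satisfies ∂²L(x)/∂x_i∂x_j = A_{*,i}^⊤ B(x) A_{*,j}, where B(x) = α(x)^{-2}·diag(z(x))·K(x)^⊤K(x)·diag(z(x)) − α(x)^{-2}·z(x)·c̃(x)^⊤·diag(z(x)) − α(x)^{-2}·diag(z(x))·c̃(x)·z(x)^⊤ + α(x)^{-1}·diag(c̃(x) ∘ exp(Ax)), with z(x) = exp(Ax) + 1_n, K(x) = I_n − f(x)·1_n^⊤, and c̃(x) = K(x)^⊤ c(x). -/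
open Matrix

variable {n d : ℕ}

lemma aux_key {d : ℕ} {g : (Fin d → ℝ) → ℝ} {x v : Fin d → ℝ} {D : ℝ}
    (hg : DifferentiableAt ℝ g x) (h : HasDerivAt (fun t : ℝ => g (x + t • v)) D 0) :
    fderiv ℝ g x v = D := by
  have h1 : HasLineDerivAt ℝ g D x v := h
  rw [← hg.lineDeriv_eq_fderiv]
  exact h1.lineDeriv

lemma aux_diff_e (A : Matrix (Fin n) (Fin d) ℝ) (x : Fin d → ℝ) (k : Fin n) :
    DifferentiableAt ℝ (fun y => expv A y k) x := by
  unfold expv Matrix.mulVec dotProduct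
  fun_prop

lemma aux_diff_u (A : Matrix (Fin n) (Fin d) ℝ) (x : Fin d → ℝ) (k : Fin n) :
    DifferentiableAt ℝ (fun y => uf A y k) x := by
  unfold uf expv Matrix.mulVec dotProduct
  fun_prop

lemma aux_diff_a (A : Matrix (Fin n) (Fin d) ℝ) (x : Fin d → ℝ) :
    DifferentiableAt ℝ (fun y => alphaf A y) x := by
  unfold alphaf
  have := aux_diff_u A x
  fun_prop

lemma aux_ff (A : Matrix (Fin n) (Fin d) ℝ) (x : Fin d → ℝ) (k : Fin n) :
    ff A x k = (alphaf A x)⁻¹ * uf A x k := rfl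

lemma aux_diff_f (A : Matrix (Fin n) (Fin d) ℝ) (x : Fin d → ℝ) (hα : alphaf A x ≠ 0)
    (k : Fin n) : DifferentiableAt ℝ (fun y => ff A y k) x := by
  simp only [aux_ff]
  exact ((aux_diff_a A x).inv hα).mul (aux_diff_u A x k)

lemma aux_diff_c (A : Matrix (Fin n) (Fin d) ℝ) (b : Fin n → ℝ) (x : Fin d → ℝ)
    (hα : alphaf A x ≠ 0) (k : Fin n) : DifferentiableAt ℝ (fun y => cf A b y k) x :=
  (aux_diff_f A x hα k).sub_const _

lemma aux_ctf (A : Matrix (Fin n) (Fin d) ℝ) (b : Fin n → ℝ) (x : Fin d → ℝ) (k : Fin n) :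
    ctf A b x k = cf A b x k - ∑ l, ff A x l * cf A b x l := by
  unfold ctf Kf
  simp [Matrix.sub_mulVec, Matrix.mulVec, dotProduct, Matrix.vecMulVec_apply, sub_mul,
    Finset.sum_sub_distrib, Matrix.one_apply]

lemma aux_diff_ct (A : Matrix (Fin n) (Fin d) ℝ) (b : Fin n → ℝ) (x : Fin d → ℝ)
    (hα : alphaf A x ≠ 0) (k : Fin n) : DifferentiableAt ℝ (fun y => ctf A b y k) x := by
  simp only [aux_ctf]
  have h1 := aux_diff_f A x hα
  have h2 := aux_diff_c A b x hα
  fun_prop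

/-- directional sum `⟨z, A_i⟩`. -/
noncomputable def auxS (A : Matrix (Fin n) (Fin d) ℝ) (x : Fin d → ℝ) (i : Fin d) : ℝ :=
  ∑ k, zf A x k * A k i

/-- `α⁻¹ K v_i`. -/
noncomputable def auxF (A : Matrix (Fin n) (Fin d) ℝ) (x : Fin d → ℝ) (i : Fin d) (k : Fin n) : ℝ :=
  (alphaf A x)⁻¹ * (zf A x k * A k i - ff A x k * auxS A x i)

lemma aux_d_m (A : Matrix (Fin n) (Fin d) ℝ) (x : Fin d → ℝ) (i : Fin d) (k : Fin n) :
    HasDerivAt (fun t : ℝ => A.mulVec (x + t • Pi.single i 1) k) (A k i) 0 := by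
  have : (fun t : ℝ => A.mulVec (x + t • Pi.single i 1) k)
      = fun t : ℝ => A.mulVec x k + t * A k i := by
    funext t
    simp [Matrix.mulVec_add, Matrix.mulVec_smul]
  rw [this]
  simpa using ((hasDerivAt_id (0 : ℝ)).mul_const (A k i)).const_add (A.mulVec x k)

lemma aux_d_e (A : Matrix (Fin n) (Fin d) ℝ) (x : Fin d → ℝ) (i : Fin d) (k : Fin n) :
    HasDerivAt (fun t : ℝ => expv A (x + t • Pi.single i 1) k) (expv A x k * A k i) 0 := by
  simpa [expv] using (aux_d_m A x i k).exp

lemma aux_d_u (A : Matrix (Fin n) (Fin d) ℝ) (x : Fin d → ℝ) (i : Fin d) (k : Fin n) :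
    HasDerivAt (fun t : ℝ => uf A (x + t • Pi.single i 1) k) (zf A x k * A k i) 0 := by
  have := (aux_d_e A x i k).add (aux_d_m A x i k)
  refine this.congr_deriv ?_
  simp [zf]; ring

lemma aux_d_a (A : Matrix (Fin n) (Fin d) ℝ) (x : Fin d → ℝ) (i : Fin d) :
    HasDerivAt (fun t : ℝ => alphaf A (x + t • Pi.single i 1)) (auxS A x i) 0 := by
  unfold alphaf auxS
  exact HasDerivAt.fun_sum fun k _ => aux_d_u A x i k

lemma aux_d_ai (A : Matrix (Fin n) (Fin d) ℝ) (x : Fin d → ℝ) (hα : alphaf A x ≠ 0) (i : Fin d) :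
    HasDerivAt (fun t : ℝ => (alphaf A (x + t • Pi.single i 1))⁻¹)
      (-(alphaf A x)⁻¹ ^ 2 * auxS A x i) 0 := by
  have := (aux_d_a A x i).fun_inv (by simpa using hα)
  refine this.congr_deriv ?_
  simp; ring

lemma aux_d_f (A : Matrix (Fin n) (Fin d) ℝ) (x : Fin d → ℝ) (hα : alphaf A x ≠ 0) (i : Fin d)
    (k : Fin n) :
    HasDerivAt (fun t : ℝ => ff A (x + t • Pi.single i 1) k) (auxF A x i k) 0 := by
  simp only [aux_ff]
  refine ((aux_d_ai A x hα i).mul (aux_d_u A x i k)).congr_deriv ?_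
  simp [auxF, aux_ff]; ring

lemma aux_d_c (A : Matrix (Fin n) (Fin d) ℝ) (b : Fin n → ℝ) (x : Fin d → ℝ)
    (hα : alphaf A x ≠ 0) (i : Fin d) (k : Fin n) :
    HasDerivAt (fun t : ℝ => cf A b (x + t • Pi.single i 1) k) (auxF A x i k) 0 :=
  (aux_d_f A x hα i k).sub_const _

/-- Moving `K` across: `⟨c̃, v⟩ = ⟨c, K v⟩`. -/
lemma aux_ct_v (A : Matrix (Fin n) (Fin d) ℝ) (b : Fin n → ℝ) (x : Fin d → ℝ) (j : Fin d) :
    (alphaf A x)⁻¹ * ∑ k, ctf A b x k * (zf A x k * A k j)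
      = ∑ k, cf A b x k * auxF A x j k := by
  simp only [aux_ctf, sub_mul, Finset.sum_sub_distrib, auxF]
  rw [← Finset.mul_sum]
  change _ * (_ - _ * auxS A x j) = _
  rw [Finset.sum_mul, ← Finset.sum_sub_distrib, Finset.mul_sum]
  exact Finset.sum_congr rfl fun k _ => by ring

lemma aux_first (A : Matrix (Fin n) (Fin d) ℝ) (b : Fin n → ℝ) (x : Fin d → ℝ)
    (hα : alphaf A x ≠ 0) (j : Fin d) :
    fderiv ℝ (Lf A b) x (Pi.single j 1)
      = (alphaf A x)⁻¹ * ∑ k, ctf A b x k * (zf A x k * A k j) := by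
  apply aux_key
  · unfold Lf
    have h2 := aux_diff_c A b x hα
    fun_prop
  · unfold Lf
    refine ((HasDerivAt.fun_sum (u := Finset.univ)
      fun k _ => (aux_d_c A b x hα j k).fun_pow 2).const_mul (0.5 : ℝ)).congr_deriv ?_
    rw [aux_ct_v, Finset.mul_sum]
    refine Finset.sum_congr rfl fun k _ => ?_
    simp; ring

lemma aux_d_ct (A : Matrix (Fin n) (Fin d) ℝ) (b : Fin n → ℝ) (x : Fin d → ℝ)
    (hα : alphaf A x ≠ 0) (i : Fin d) (k : Fin n) :
    HasDerivAt (fun t : ℝ => ctf A b (x + t • Pi.single i 1) k)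
      (auxF A x i k - ∑ l, (auxF A x i l * cf A b x l + ff A x l * auxF A x i l)) 0 := by
  simp only [aux_ctf]
  refine ((aux_d_c A b x hα i k).fun_sub (HasDerivAt.fun_sum (u := Finset.univ)
    fun l _ => (aux_d_f A x hα i l).fun_mul (aux_d_c A b x hα i l))).congr_deriv ?_
  simp

lemma aux_second (A : Matrix (Fin n) (Fin d) ℝ) (b : Fin n → ℝ) (x : Fin d → ℝ)
    (hα : alphaf A x ≠ 0) (i j : Fin d) :
    fderiv ℝ (fun y => fderiv ℝ (Lf A b) y (Pi.single j 1)) x (Pi.single i 1)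
      = -(alphaf A x)⁻¹ ^ 2 * auxS A x i * ∑ k, ctf A b x k * (zf A x k * A k j)
        + (alphaf A x)⁻¹ * ∑ k, ((auxF A x i k
            - ∑ l, (auxF A x i l * cf A b x l + ff A x l * auxF A x i l)) * (zf A x k * A k j)
          + ctf A b x k * (expv A x k * A k i * A k j)) := by
  have hev : (fun y => fderiv ℝ (Lf A b) y (Pi.single j 1)) =ᶠ[nhds x]
      fun y => (alphaf A y)⁻¹ * ∑ k, ctf A b y k * (zf A y k * A k j) := by
    filter_upwards [(aux_diff_a A x).continuousAt.eventually_ne hα] with y hy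
    exact aux_first A b y hy j
  rw [hev.fderiv_eq]
  apply aux_key
  · have h1 := (aux_diff_a A x).fun_inv hα
    have h2 := aux_diff_ct A b x hα
    have h3 := aux_diff_e A x
    unfold zf
    fun_prop
  · refine ((aux_d_ai A x hα i).fun_mul (HasDerivAt.fun_sum (u := Finset.univ)
      fun k _ => (aux_d_ct A b x hα i k).fun_mul
        (((aux_d_e A x i k).add_const 1).mul_const (A k j)))).congr_deriv ?_
    simp [zf]

lemma aux_Kv (A : Matrix (Fin n) (Fin d) ℝ) (x : Fin d → ℝ) (i : Fin d) (k : Fin n) :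
    (alphaf A x)⁻¹ * (Kf A x *ᵥ (diagonal (zf A x) *ᵥ fun k => A k i)) k = auxF A x i k := by
  unfold Kf auxF auxS
  rw [Matrix.sub_mulVec, Matrix.vecMulVec_mulVec, Matrix.one_mulVec]
  simp [Matrix.mulVec_diagonal, dotProduct, -Matrix.mulVec_mulVec]

lemma aux_mat (A : Matrix (Fin n) (Fin d) ℝ) (x : Fin d → ℝ) (i j : Fin d) :
    (fun k => A k i) ⬝ᵥ (Bmat A x *ᵥ fun k => A k j) = ∑ k, auxF A x i k * auxF A x j k := by
  unfold Bmat
  rw [Matrix.smul_mulVec, dotProduct_smul, ← Matrix.mulVec_mulVec, ← Matrix.mulVec_mulVec,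
    ← Matrix.mulVec_mulVec, Matrix.dotProduct_mulVec, ← Matrix.mulVec_transpose,
    Matrix.diagonal_transpose, Matrix.dotProduct_mulVec, ← Matrix.mulVec_transpose,
    Matrix.transpose_transpose]
  simp only [← aux_Kv]
  rw [dotProduct, smul_eq_mul, Finset.mul_sum]
  refine Finset.sum_congr rfl fun k _ => ?_
  rw [← inv_pow]; ring

lemma aux_rank (A : Matrix (Fin n) (Fin d) ℝ) (b : Fin n → ℝ) (x : Fin d → ℝ) (i j : Fin d) :
    (fun k => A k i) ⬝ᵥ (Brank A b x *ᵥ fun k => A k j)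
      = (alphaf A x)⁻¹ ^ 2 * (auxS A x i * (∑ k, ctf A b x k * (zf A x k * A k j))
        + (∑ k, ctf A b x k * (zf A x k * A k i)) * auxS A x j) := by
  unfold Brank
  rw [Matrix.smul_mulVec, dotProduct_smul, Matrix.add_mulVec, dotProduct_add,
    ← Matrix.mulVec_mulVec, ← Matrix.mulVec_mulVec, Matrix.vecMulVec_mulVec,
    Matrix.vecMulVec_mulVec, smul_eq_mul, ← inv_pow]
  congr 1
  simp only [dotProduct, auxS, Matrix.mulVec_diagonal, Finset.sum_mul_sum]
  congr 1
  · simp [Finset.mul_sum, Matrix.mulVec_diagonal, dotProduct]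
    refine Finset.sum_congr rfl fun k _ => Finset.sum_congr rfl fun l _ => by ring
  · simp [Finset.mul_sum, Matrix.mulVec_diagonal, dotProduct]
    refine Finset.sum_congr rfl fun k _ => Finset.sum_congr rfl fun l _ => by ring

lemma aux_diag (A : Matrix (Fin n) (Fin d) ℝ) (b : Fin n → ℝ) (x : Fin d → ℝ) (i j : Fin d) :
    (fun k => A k i) ⬝ᵥ (Bdiag A b x *ᵥ fun k => A k j)
      = (alphaf A x)⁻¹ * ∑ k, ctf A b x k * (expv A x k * A k i * A k j) := by
  unfold Bdiag
  rw [Matrix.smul_mulVec, dotProduct_smul, smul_eq_mul]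
  congr 1
  simp only [dotProduct, Matrix.mulVec_diagonal]
  exact Finset.sum_congr rfl fun k _ => by ring

/-- if α(x) ≠ 0, then ∂²L/∂x_i∂x_j = A_{*,i}ᵀ B(x) A_{*,j}. -/
theorem stmt4 (n d : ℕ) (A : Matrix (Fin n) (Fin d) ℝ) (b : Fin n → ℝ) (x : Fin d → ℝ)
    (hα : alphaf A x ≠ 0) (i j : Fin d) :
    fderiv ℝ (fun y => fderiv ℝ (Lf A b) y (Pi.single j 1)) x (Pi.single i 1)
      = (fun k => A k i) ⬝ᵥ (Bf A b x *ᵥ fun k => A k j) := by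
  rw [aux_second A b x hα, Bf, Matrix.add_mulVec, Matrix.sub_mulVec, dotProduct_add, dotProduct_sub,
    aux_mat, aux_rank, aux_diag, Finset.sum_add_distrib]
  have e1 := aux_ct_v A b x i
  have e2 : ∑ l, (auxF A x i l * cf A b x l + ff A x l * auxF A x i l)
      = (∑ k, cf A b x k * auxF A x i k) + ∑ k, ff A x k * auxF A x i k := by
    rw [← Finset.sum_add_distrib]
    exact Finset.sum_congr rfl fun k _ => by ring
  have e3 : ∑ k, auxF A x i k * auxF A x j k = (alphaf A x)⁻¹ *
      ((∑ k, auxF A x i k * (zf A x k * A k j)) - (∑ k, ff A x k * auxF A x i k) * auxS A x j) := by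
    rw [Finset.sum_mul, ← Finset.sum_sub_distrib, Finset.mul_sum]
    refine Finset.sum_congr rfl fun k _ => ?_
    rw [auxF.eq_1 A x j]; ring
  rw [e2, e3, ← e1]
  simp only [sub_mul, Finset.sum_sub_distrib]
  rw [← Finset.mul_sum (f := fun k => zf A x k * A k j), ← auxS.eq_1 A x j]
  ring
end

section
/- Let R ≥ 4, ‖A‖ ≤ R (spectral norm), ‖x‖_2 ≤ R, β ∈ (0, 0.1), and ⟨exp(Ax) + Ax, 1_n⟩ ≥ β. Set R_{f,2} = 2√n · β^{-1} · exp(R²). Then the matrix K(x) = I_n − f(x)·1_n^⊤ satisfies ‖K(x)‖ ≤ 3√n · R_{f,2} in spectral norm. -/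
open Matrix

variable {n d : ℕ}

theorem toLp_norm_eq_vecNorm2 {m : ℕ} (v : Fin m → ℝ) : ‖WithLp.toLp 2 v‖ = vecNorm2 v := by
  simp [EuclideanSpace.norm_eq, vecNorm2]

theorem abs_coord_le {m : ℕ} (v : EuclideanSpace ℝ (Fin m)) (j : Fin m) : |v j| ≤ ‖v‖ := by
  simpa using PiLp.norm_apply_le v j

theorem norm_le_sqrt_mul {m : ℕ} (v : EuclideanSpace ℝ (Fin m)) (C : ℝ) (hC : 0 ≤ C)
    (h : ∀ j, |v j| ≤ C) : ‖v‖ ≤ Real.sqrt m * C := by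
  rw [EuclideanSpace.norm_eq]
  have h1 : ∑ i, ‖v i‖ ^ 2 ≤ ∑ _i : Fin m, C ^ 2 := by
    apply Finset.sum_le_sum
    intro i _
    rw [Real.norm_eq_abs]
    exact pow_le_pow_left₀ (abs_nonneg _) (h i) 2
  calc Real.sqrt (∑ i, ‖v i‖ ^ 2) ≤ Real.sqrt (m * C ^ 2) := by
        apply Real.sqrt_le_sqrt
        simpa using h1
    _ = Real.sqrt m * C := by
        rw [Real.sqrt_mul (by positivity), Real.sqrt_sq hC]

theorem abs_sum_le_sqrt_mul {m : ℕ} (v : EuclideanSpace ℝ (Fin m)) :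
    |∑ j, v j| ≤ Real.sqrt m * ‖v‖ := by
  rw [EuclideanSpace.norm_eq, ← Real.sqrt_mul (by positivity)]
  apply Real.abs_le_sqrt
  have := sq_sum_le_card_mul_sum_sq (s := (Finset.univ : Finset (Fin m))) (f := fun j => v j)
  simpa using this

/-- ‖K(x)‖ ≤ 3√n · R_{f,2}, where R_{f,2} = 2√n·β⁻¹·exp(R²). -/
theorem stmt12 (n d : ℕ) (A : Matrix (Fin n) (Fin d) ℝ) (x : Fin d → ℝ) (R β : ℝ)
    (hR : 4 ≤ R) (hA : specNorm A ≤ R) (hx : vecNorm2 x ≤ R)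
    (hβ0 : 0 < β) (hβ1 : β < 0.1) (hβα : β ≤ alphaf A x) :
    specNorm (Kf A x) ≤ 3 * Real.sqrt n * (2 * Real.sqrt n * β⁻¹ * Real.exp (R ^ 2)) := by
  have hR2 : 0 ≤ R := by linarith
  have hAx : ∀ j, |(A *ᵥ x) j| ≤ R ^ 2 := by
    intro j
    have h1 := (Matrix.toEuclideanLin A).toContinuousLinearMap.le_opNorm (WithLp.toLp 2 x)
    have h2 := abs_coord_le ((Matrix.toEuclideanLin A).toContinuousLinearMap (WithLp.toLp 2 x)) j
    rw [toLp_norm_eq_vecNorm2 x] at h1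
    have h3 : ((Matrix.toEuclideanLin A).toContinuousLinearMap (WithLp.toLp 2 x)) j
        = (A *ᵥ x) j := by
      simp [Matrix.toLpLin_apply]
    rw [h3] at h2
    have h4 : specNorm A * vecNorm2 x ≤ R * R :=
      mul_le_mul hA hx (Real.sqrt_nonneg _) hR2
    have h5 : _ ≤ specNorm A * vecNorm2 x := h1
    nlinarith
  have hα : 0 < alphaf A x := by linarith
  have hf : ∀ j, |ff A x j| ≤ 2 * β⁻¹ * Real.exp (R ^ 2) := by
    intro j
    have h1 : |uf A x j| ≤ 2 * Real.exp (R ^ 2) := by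
      have h2 : Real.exp ((A *ᵥ x) j) ≤ Real.exp (R ^ 2) :=
        Real.exp_le_exp.2 ((le_abs_self _).trans (hAx j))
      have h3 := Real.add_one_le_exp (R ^ 2)
      have h4 := Real.exp_pos ((A *ᵥ x) j)
      have h5 := abs_le.1 (hAx j)
      simp only [uf, expv]
      rw [abs_le]
      constructor <;> linarith [h5.1, h5.2]
    have h2 : (alphaf A x)⁻¹ ≤ β⁻¹ := inv_anti₀ hβ0 hβα
    simp only [ff, Pi.smul_apply, smul_eq_mul, abs_mul, abs_of_pos (inv_pos.2 hα)]
    calc (alphaf A x)⁻¹ * |uf A x j| ≤ β⁻¹ * (2 * Real.exp (R ^ 2)) := by gcongr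
      _ = _ := by ring
  have hfn : ‖WithLp.toLp 2 (ff A x)‖ ≤ Real.sqrt n * (2 * β⁻¹ * Real.exp (R ^ 2)) :=
    norm_le_sqrt_mul _ _ (by positivity) hf
  have hn : 1 ≤ Real.sqrt n := by
    rw [Real.one_le_sqrt]
    rcases Nat.eq_zero_or_pos n with h | h
    · subst h
      simp [alphaf] at hα
    · exact_mod_cast h
  have hone : 1 ≤ 2 * β⁻¹ * Real.exp (R ^ 2) := by
    have h1 : 1 ≤ β⁻¹ := (one_le_inv₀ hβ0).2 (by norm_num at hβ1; linarith)
    have h2 : 1 ≤ Real.exp (R ^ 2) := Real.one_le_exp (by positivity)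
    nlinarith
  set F := 2 * β⁻¹ * Real.exp (R ^ 2) with hF
  have hbig : 1 ≤ Real.sqrt n * (Real.sqrt n * F) :=
    one_le_mul_of_one_le_of_one_le hn (one_le_mul_of_one_le_of_one_le hn hone)
  have hK : specNorm (Kf A x) ≤ 1 + Real.sqrt n * (Real.sqrt n * F) := by
    apply ContinuousLinearMap.opNorm_le_bound _ (by positivity)
    intro v
    have h1 : (Matrix.toEuclideanLin (Kf A x)).toContinuousLinearMap v
        = v - (∑ j, v j) • WithLp.toLp 2 (ff A x) := by
      ext j
      simp [Matrix.toLpLin_apply, Kf, Matrix.sub_mulVec, Matrix.mulVec, dotProduct,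
        vecMulVec_apply, ← Finset.mul_sum, Matrix.one_apply, mul_comm]
    rw [h1]
    calc _ ≤ ‖v‖ + ‖(∑ j, v j) • WithLp.toLp 2 (ff A x)‖ := norm_sub_le _ _
      _ = ‖v‖ + |∑ j, v j| * ‖WithLp.toLp 2 (ff A x)‖ := by rw [norm_smul, Real.norm_eq_abs]
      _ ≤ ‖v‖ + (Real.sqrt n * ‖v‖) * (Real.sqrt n * F) := by
          gcongr
          exact abs_sum_le_sqrt_mul v
      _ = _ := by ring
  have : 3 * Real.sqrt n * (2 * Real.sqrt n * β⁻¹ * Real.exp (R ^ 2))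
      = 3 * (Real.sqrt n * (Real.sqrt n * F)) := by rw [hF]; ring
  rw [this]
  linarith
end

section
/- Let R ≥ 4, ‖A‖ ≤ R (spectral norm), ‖x‖_2 ≤ R, ‖b‖_1 ≤ 1, β ∈ (0, 0.1), and ⟨exp(Ax) + Ax, 1_n⟩ ≥ β. Set R_{f,2} = 2√n · β^{-1} · exp(R²). Then the vector c̃(x) = K(x)^⊤ c(x) satisfies ‖c̃(x)‖_2 ≤ 10√n · R_{f,2}². -/
open Matrix

variable {n d : ℕ}

/-- ‖c̃(x)‖₂ ≤ 10√n · R_{f,2}², where R_{f,2} = 2√n·β⁻¹·exp(R²). -/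
theorem stmt13 (n d : ℕ) (A : Matrix (Fin n) (Fin d) ℝ) (b : Fin n → ℝ) (x : Fin d → ℝ)
    (R β : ℝ) (hR : 4 ≤ R) (hA : specNorm A ≤ R) (hx : vecNorm2 x ≤ R) (hb : vecNorm1 b ≤ 1)
    (hβ0 : 0 < β) (hβ1 : β < 0.1) (hβα : β ≤ alphaf A x) :
    vecNorm2 (ctf A b x)
      ≤ 10 * Real.sqrt n * (2 * Real.sqrt n * β⁻¹ * Real.exp (R ^ 2)) ^ 2 := by
  have hn : (1 : ℝ) ≤ n := by
    rcases Nat.eq_zero_or_pos n with h | h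
    · subst h
      simp [alphaf] at hβα
      linarith
    · exact_mod_cast h
  have hAx : ∀ j, |A.mulVec x j| ≤ R ^ 2 := by
    intro j
    have h1 := (Matrix.toEuclideanLin A).toContinuousLinearMap.le_opNorm (WithLp.toLp 2 x)
    have h2 : ‖(WithLp.toLp 2 x : EuclideanSpace ℝ (Fin d))‖ ≤ R := by
      rw [EuclideanSpace.norm_eq]
      simpa [vecNorm2] using hx
    have h3 := PiLp.norm_apply_le ((Matrix.toEuclideanLin A).toContinuousLinearMap (WithLp.toLp 2 x)) j
    have h4 : ((Matrix.toEuclideanLin A).toContinuousLinearMap (WithLp.toLp 2 x)) j = A.mulVec x j := by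
      simp [Matrix.toLpLin_apply]
    rw [h4, Real.norm_eq_abs] at h3
    have h5 : specNorm A * ‖(WithLp.toLp 2 x : EuclideanSpace ℝ (Fin d))‖ ≤ R * R :=
      mul_le_mul hA h2 (norm_nonneg _) (by linarith)
    unfold specNorm at h5
    nlinarith
  have hα : 0 < alphaf A x := lt_of_lt_of_le hβ0 hβα
  set E := Real.exp (R ^ 2) with hE
  have hE1 : R ^ 2 + 1 ≤ E := Real.add_one_le_exp _
  have hu : ∀ j, |uf A x j| ≤ 2 * E := by
    intro j
    have h1 := hAx j
    have h2 : Real.exp (A.mulVec x j) ≤ E := Real.exp_le_exp.2 (le_trans (le_abs_self _) h1)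
    have h3 := Real.exp_pos (A.mulVec x j)
    unfold uf expv
    rw [abs_le] at *
    constructor <;> linarith
  set F := 2 * E * β⁻¹ with hF
  have hβi : 1 ≤ β⁻¹ := by
    rw [one_le_inv₀ hβ0]; norm_num at hβ1; linarith
  have hF1 : 1 ≤ F := by rw [hF]; nlinarith
  have hf : ∀ j, |ff A x j| ≤ F := by
    intro j
    have : ff A x j = (alphaf A x)⁻¹ * uf A x j := rfl
    rw [this, abs_mul, abs_of_pos (inv_pos.2 hα), mul_comm]
    exact mul_le_mul (hu j) (inv_anti₀ hβ0 hβα) (inv_pos.2 hα).le (by positivity)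
  have hbj : ∀ j, |b j| ≤ 1 := fun j =>
    le_trans (Finset.single_le_sum (f := fun i => |b i|) (fun i _ => abs_nonneg _) (Finset.mem_univ j)) hb
  have hc : ∀ j, |cf A b x j| ≤ F + |b j| := fun j =>
    (abs_sub _ _).trans (by linarith [hf j])
  have hs : |∑ i, ff A x i * cf A b x i| ≤ n * F ^ 2 + F := by
    calc |∑ i, ff A x i * cf A b x i| ≤ ∑ i, |ff A x i * cf A b x i| := Finset.abs_sum_le_sum_abs _ _
      _ ≤ ∑ i : Fin n, F * (F + |b i|) := by
        apply Finset.sum_le_sum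
        intro i _
        rw [abs_mul]
        exact mul_le_mul (hf i) (hc i) (abs_nonneg _) (by linarith)
      _ = n * F ^ 2 + F * vecNorm1 b := by
        rw [← Finset.mul_sum, Finset.sum_add_distrib]
        simp [vecNorm1]; ring
      _ ≤ n * F ^ 2 + F := by nlinarith
  have hct : ∀ j, ctf A b x j = cf A b x j - ∑ i, ff A x i * cf A b x i := by
    intro j
    simp [ctf, Kf, Matrix.sub_mulVec, Matrix.mulVec, dotProduct, Matrix.vecMulVec_apply, sub_mul,
      Finset.sum_sub_distrib, Matrix.one_apply]
  have hG : F ≤ n * F ^ 2 := by nlinarith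
  have hctb : ∀ j, |ctf A b x j| ≤ 4 * (n * F ^ 2) := by
    intro j
    rw [hct]
    refine (abs_sub _ _).trans ?_
    linarith [hc j, hbj j]
  have hfin : (2 * Real.sqrt n * β⁻¹ * E) ^ 2 = n * F ^ 2 := by
    have := Real.sq_sqrt (show (0 : ℝ) ≤ n by linarith)
    calc _ = (Real.sqrt n) ^ 2 * F ^ 2 := by rw [hF]; ring
      _ = _ := by rw [this]
  rw [hfin]
  have hM : 0 ≤ n * F ^ 2 := by positivity
  unfold vecNorm2
  apply Real.sqrt_le_iff.2
  refine ⟨by positivity, ?_⟩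
  calc ∑ i, (ctf A b x i) ^ 2 ≤ ∑ i : Fin n, (4 * (n * F ^ 2)) ^ 2 := by
        apply Finset.sum_le_sum
        intro i _
        exact sq_le_sq' (abs_le.1 (hctb i)).1 (abs_le.1 (hctb i)).2
    _ = n * (4 * (n * F ^ 2)) ^ 2 := by simp
    _ ≤ n * (10 * (n * F ^ 2)) ^ 2 := by gcongr; norm_num
    _ = (Real.sqrt n) ^ 2 * (10 * (n * F ^ 2)) ^ 2 := by rw [Real.sq_sqrt (by linarith)]
    _ = _ := by ring
end

section
/- Let ‖A‖ ≤ R (spectral norm), ‖x‖_2 ≤ R, and ‖y‖_2 ≤ R, with R ≥ 4. Then |α(x) − α(y)| ≤ 2√n · R · exp(R²) · ‖x − y‖_2, where α(x) = ⟨exp(Ax) + Ax, 1_n⟩. -/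
open Matrix

variable {n d : ℕ}

theorem vecNorm2_eq_aux {m : ℕ} (v : Fin m → ℝ) : vecNorm2 v = ‖WithLp.toLp 2 v‖ := by
  simp [vecNorm2, EuclideanSpace.norm_eq]

theorem mulVec_norm_aux {m k : ℕ} (A : Matrix (Fin m) (Fin k) ℝ) (v : Fin k → ℝ) :
    vecNorm2 (A *ᵥ v) ≤ specNorm A * vecNorm2 v := by
  rw [vecNorm2_eq_aux, vecNorm2_eq_aux]
  exact (Matrix.toEuclideanLin A).toContinuousLinearMap.le_opNorm (WithLp.toLp 2 v)

theorem coord_le_aux {m : ℕ} (v : Fin m → ℝ) (i : Fin m) : v i ≤ vecNorm2 v := by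
  apply Real.le_sqrt_of_sq_le
  exact Finset.single_le_sum (f := fun i => (v i) ^ 2) (fun i _ => sq_nonneg _) (Finset.mem_univ i)

theorem exp_sub_aux {a b c : ℝ} (ha : a ≤ c) (hab : b ≤ a) :
    |Real.exp a - Real.exp b| ≤ Real.exp c * |a - b| := by
  rw [abs_of_nonneg (sub_nonneg.2 (Real.exp_le_exp.2 hab)), abs_of_nonneg (sub_nonneg.2 hab)]
  have h1 : Real.exp b = Real.exp a * Real.exp (b - a) := by
    rw [← Real.exp_add]; congr 1; ring
  have h2 := Real.add_one_le_exp (b - a)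
  have h3 := Real.exp_le_exp.2 ha
  have h4 := Real.exp_pos a
  calc Real.exp a - Real.exp b ≤ Real.exp a * (a - b) := by rw [h1]; nlinarith
    _ ≤ _ := by gcongr

theorem exp_lip_aux {a b c : ℝ} (ha : a ≤ c) (hb : b ≤ c) :
    |Real.exp a - Real.exp b| ≤ Real.exp c * |a - b| := by
  rcases le_total b a with h | h
  · exact exp_sub_aux ha h
  · rw [abs_sub_comm, abs_sub_comm a]; exact exp_sub_aux hb h

theorem l1_le_aux {m : ℕ} (v : Fin m → ℝ) : ∑ i, |v i| ≤ Real.sqrt m * vecNorm2 v := by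
  unfold vecNorm2
  rw [← Real.sqrt_mul (by positivity)]
  apply Real.le_sqrt_of_sq_le
  have := sq_sum_le_card_mul_sum_sq (s := Finset.univ) (f := fun i => |v i|)
  simpa using this

/-- |α(x) − α(y)| ≤ 2√n·R·exp(R²)·‖x − y‖₂. -/
theorem stmt15 (n d : ℕ) (A : Matrix (Fin n) (Fin d) ℝ) (x y : Fin d → ℝ) (R : ℝ)
    (hR : 4 ≤ R) (hA : specNorm A ≤ R) (hx : vecNorm2 x ≤ R) (hy : vecNorm2 y ≤ R) :
    |alphaf A x - alphaf A y| ≤ 2 * Real.sqrt n * R * Real.exp (R ^ 2) * vecNorm2 (x - y) := by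
  have hR0 : 0 ≤ R := by linarith
  have bd : ∀ z : Fin d → ℝ, vecNorm2 z ≤ R → ∀ j, (A *ᵥ z) j ≤ R ^ 2 := by
    intro z hz j
    have hz0 : 0 ≤ vecNorm2 z := Real.sqrt_nonneg _
    calc (A *ᵥ z) j ≤ vecNorm2 (A *ᵥ z) := coord_le_aux _ j
      _ ≤ specNorm A * vecNorm2 z := mulVec_norm_aux A z
      _ ≤ R * R := by gcongr
      _ = R ^ 2 := by ring
  have hN : 0 ≤ vecNorm2 (x - y) := Real.sqrt_nonneg _
  have h1 : (1 : ℝ) ≤ Real.exp (R ^ 2) := Real.one_le_exp (by positivity)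
  have key : ∀ j, |uf A x j - uf A y j| ≤ 2 * Real.exp (R ^ 2) * |(A *ᵥ (x - y)) j| := by
    intro j
    have e := exp_lip_aux (bd x hx j) (bd y hy j)
    have hs : (A *ᵥ (x - y)) j = (A *ᵥ x) j - (A *ᵥ y) j := by
      rw [Matrix.mulVec_sub]; rfl
    rw [hs]
    have e2 : uf A x j - uf A y j = (Real.exp ((A *ᵥ x) j) - Real.exp ((A *ᵥ y) j))
        + ((A *ᵥ x) j - (A *ᵥ y) j) := by
      simp only [uf, expv]; ring
    rw [e2]
    refine (abs_add_le _ _).trans ?_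
    nlinarith [abs_nonneg ((A *ᵥ x) j - (A *ᵥ y) j)]
  calc |alphaf A x - alphaf A y| = |∑ j, (uf A x j - uf A y j)| := by
        simp only [alphaf, Finset.sum_sub_distrib]
    _ ≤ ∑ j, |uf A x j - uf A y j| := Finset.abs_sum_le_sum_abs _ _
    _ ≤ ∑ j, 2 * Real.exp (R ^ 2) * |(A *ᵥ (x - y)) j| := Finset.sum_le_sum fun j _ => key j
    _ = 2 * Real.exp (R ^ 2) * ∑ j, |(A *ᵥ (x - y)) j| := by rw [Finset.mul_sum]
    _ ≤ 2 * Real.exp (R ^ 2) * (Real.sqrt n * (R * vecNorm2 (x - y))) := by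
        gcongr
        refine (l1_le_aux _).trans ?_
        gcongr
        exact (mulVec_norm_aux A _).trans (by gcongr)
    _ = _ := by ring
end
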